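/- Let L > 0, η > 0, a ≥ 0 with a·η < 1, b ≥ 0, c ≥ 0, and T ≥ 1 a natural number. Let (r_t)_{0≤t≤T}, (e_t)_{0≤t<T}, (D_t)_{0≤t<T} be nonnegative reals, define ω_t := (1 − a·η)^{−(t+1)} and W_T := Σ_{t=0}^{T−1} ω_t, and assume: (i) r_{t+1} ≤ (1 − a·η)·r_t − η·e_t + b·η² + 2·L·η·D_t for all 0 ≤ t < T, and (ii) Σ_{t=0}^{T−1} ω_t·D_t ≤ (1/(4L))·Σ_{t=0}^{T−1} ω_t·e_t + c·η²·W_T. Then (1/W_T) · Σ_{t=0}^{T−1} ω_t·e_t ≤ 2·(r_0/η)·exp(−a·η·T) + 2·b·η + 4·L·c·η². -/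

import Mathlib

/-- Unrolling a perturbed linear contraction with the weights `q⁻¹ ^ (t + 1)`. -/
theorem weighted_le_add_sum_of_le_mul_add {q : ℝ} (hq : 0 < q) {r g : ℕ → ℝ} {T : ℕ}
    (h : ∀ t < T, r (t + 1) ≤ q * r t + g t) :
    (q ^ T)⁻¹ * r T ≤ r 0 + ∑ t ∈ Finset.range T, (q ^ (t + 1))⁻¹ * g t := by
  induction T with
  | zero => simp
  | succ n ih =>
    rw [Finset.sum_range_succ]
    have hstep := mul_le_mul_of_nonneg_left (h n n.lt_succ_self)
      (inv_nonneg.mpr (pow_pos hq (n + 1)).le)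
    have hcancel : (q ^ (n + 1))⁻¹ * (q * r n + g n)
        = (q ^ n)⁻¹ * r n + (q ^ (n + 1))⁻¹ * g n := by
      field_simp
      ring
    linarith [ih fun t ht => h t (ht.trans n.lt_succ_self)]

/-- The geometric weights `((1 - x) ^ (t + 1))⁻¹` sum to at least `exp (x * T)`. -/
theorem exp_mul_le_sum_inv_one_sub_pow {x : ℝ} (hx : x < 1) {T : ℕ} (hT : 1 ≤ T) :
    Real.exp (x * T) ≤ ∑ t ∈ Finset.range T, ((1 - x) ^ (t + 1))⁻¹ := by
  have hq : 0 < 1 - x := sub_pos.mpr hx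
  have hpow : (1 - x) ^ T ≤ Real.exp (-(x * T)) := by
    calc (1 - x) ^ T ≤ Real.exp (-x) ^ T :=
          pow_le_pow_left₀ hq.le (Real.one_sub_le_exp_neg x) T
      _ = Real.exp (-(x * T)) := by rw [← Real.exp_nat_mul]; ring_nf
  have hlast : ((1 - x) ^ T)⁻¹ ≤ ∑ t ∈ Finset.range T, ((1 - x) ^ (t + 1))⁻¹ := by
    have := Finset.single_le_sum (f := fun t => ((1 - x) ^ (t + 1))⁻¹)
      (fun t _ => inv_nonneg.mpr (pow_pos hq (t + 1)).le)
      (Finset.mem_range.mpr (Nat.sub_lt hT one_pos))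
    simpa only [Nat.sub_add_cancel hT] using this
  refine le_trans ?_ hlast
  rw [← neg_neg (x * T), Real.exp_neg]
  exact inv_anti₀ (pow_pos hq T) hpow


/-- Abstract combination of Lemma 1 and Lemma 3 yielding the strongly convex rate of
Theorem 1: a weighted recursion with a deviation term that is itself controlled by the
weighted suboptimality sum. -/
theorem stmt_15 (L η a b c : ℝ) (hL : 0 < L) (hη : 0 < η) (ha : 0 ≤ a) (haη : a * η < 1)
    (hb : 0 ≤ b) (hc : 0 ≤ c) (T : ℕ) (hT : 1 ≤ T)
    (r e D : ℕ → ℝ)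
    (hr : ∀ t ≤ T, 0 ≤ r t) (he : ∀ t < T, 0 ≤ e t) (hD : ∀ t < T, 0 ≤ D t)
    (ω : ℕ → ℝ) (hω : ∀ t, ω t = ((1 - a * η) ^ (t + 1))⁻¹)
    (W : ℝ) (hW : W = ∑ t ∈ Finset.range T, ω t)
    (hrec : ∀ t < T, r (t + 1) ≤ (1 - a * η) * r t - η * e t + b * η ^ 2 + 2 * L * η * D t)
    (hdev : ∑ t ∈ Finset.range T, ω t * D t
      ≤ (1 / (4 * L)) * ∑ t ∈ Finset.range T, ω t * e t + c * η ^ 2 * W) :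
    (1 / W) * ∑ t ∈ Finset.range T, ω t * e t
      ≤ 2 * (r 0 / η) * Real.exp (-(a * η * (T : ℝ))) + 2 * b * η + 4 * L * c * η ^ 2 := by
  have hq : 0 < 1 - a * η := sub_pos.mpr haη
  have hexp : Real.exp (a * η * T) ≤ W := by
    simpa only [hW, hω] using exp_mul_le_sum_inv_one_sub_pow haη hT
  have hWpos : 0 < W := (Real.exp_pos _).trans_le hexp
  have hinv : W⁻¹ ≤ Real.exp (-(a * η * (T : ℝ))) := by
    rw [Real.exp_neg]
    exact inv_anti₀ (Real.exp_pos _) hexp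
  set E := ∑ t ∈ Finset.range T, ω t * e t with hE
  have hunroll := weighted_le_add_sum_of_le_mul_add hq (r := r) (T := T)
    (g := fun t => -η * e t + b * η ^ 2 + 2 * L * η * D t)
    fun t ht => by linarith [hrec t ht]
  have hsum : ∑ t ∈ Finset.range T,
      ((1 - a * η) ^ (t + 1))⁻¹ * (-η * e t + b * η ^ 2 + 2 * L * η * D t)
      = -η * E + b * η ^ 2 * W + 2 * L * η * ∑ t ∈ Finset.range T, ω t * D t := by
    rw [hE, hW, Finset.mul_sum, Finset.mul_sum, Finset.mul_sum, ← Finset.sum_add_distrib,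
      ← Finset.sum_add_distrib]
    refine Finset.sum_congr rfl fun t _ => ?_
    rw [hω]
    ring
  rw [hsum] at hunroll
  have hlhs : 0 ≤ ((1 - a * η) ^ T)⁻¹ * r T :=
    mul_nonneg (inv_nonneg.mpr (pow_pos hq T).le) (hr T le_rfl)
  have hdev' : 2 * L * η * ∑ t ∈ Finset.range T, ω t * D t
      ≤ η * E / 2 + 2 * L * c * η ^ 3 * W := by
    calc _ ≤ 2 * L * η * ((1 / (4 * L)) * E + c * η ^ 2 * W) := by gcongr
      _ = _ := by field_simp; ring
  have hEbound : E ≤ 2 * (r 0 / η) + (2 * b * η + 4 * L * c * η ^ 2) * W := by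
    refine le_of_mul_le_mul_left ?_ hη
    have : η * (2 * (r 0 / η) + (2 * b * η + 4 * L * c * η ^ 2) * W)
        = 2 * r 0 + 2 * b * η ^ 2 * W + 4 * L * c * η ^ 3 * W := by
      field_simp
      ring
    linarith
  have hr0 : 0 ≤ 2 * (r 0 / η) := by
    have := hr 0 T.zero_le
    positivity
  calc 1 / W * E
      ≤ 1 / W * (2 * (r 0 / η) + (2 * b * η + 4 * L * c * η ^ 2) * W) := by gcongr
    _ = 2 * (r 0 / η) * W⁻¹ + (2 * b * η + 4 * L * c * η ^ 2) := by field_simp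
    _ ≤ 2 * (r 0 / η) * Real.exp (-(a * η * (T : ℝ)))
        + (2 * b * η + 4 * L * c * η ^ 2) := by gcongr
    _ = _ := by ring
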